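/- (Multivariate q-Vandermonde formula, second rising version.) Let n ≥ 1 and k ≥ 1 be integers, let q > 0 be real with q ≠ 1, and let x_1,…,x_{k+1} be real numbers. Then [x_1+x_2+⋯+x_{k+1}+n−1]_{n,q} = Σ [n; r_1,…,r_k]_q · q^{Σ_{j=1}^{k} x_j(n−s_j)} · ∏_{j=1}^{k+1}[x_j+r_j−1]_{r_j,q}, where the sum is over all nonnegative integers r_1,…,r_k with r_1+⋯+r_k ≤ n, s_j = r_1+⋯+r_j, r_{k+1} = n − s_k, and q raised to a real exponent denotes the real power. -/

import Mathlib

open Finset Filter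

noncomputable def qNum (q x : ℝ) : ℝ := (1 - q ^ x) / (1 - q)

noncomputable def qFact (q x : ℝ) (r : ℕ) : ℝ :=
  ∏ i ∈ Finset.range r, qNum q (x - i)

noncomputable def qFactorial (q : ℝ) (r : ℕ) : ℝ :=
  ∏ i ∈ Finset.range r, qNum q (i + 1)

noncomputable def qBinom (q x : ℝ) (r : ℕ) : ℝ := qFact q x r / qFactorial q r

noncomputable def qMultinom {k : ℕ} (q x : ℝ) (r : Fin k → ℕ) : ℝ :=
  qFact q x (∑ i, r i) / ∏ i, qFactorial q (r i)

theorem qFact_rising (q x : ℝ) (r : ℕ) :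
    qFact q (x + r - 1) r = ∏ i ∈ Finset.range r, qNum q (x + i) := by
  rw [qFact, ← Finset.prod_range_reflect]
  refine Finset.prod_congr rfl fun i hi => ?_
  have h : i + 1 ≤ r := Finset.mem_range.1 hi
  rw [Nat.sub_sub, Nat.cast_sub (by omega)]
  congr 1
  push_cast
  ring

theorem qNum_natCast_succ_ne_zero {q : ℝ} (hq0 : 0 < q) (hq1 : q ≠ 1) (i : ℕ) :
    qNum q ((i : ℝ) + 1) ≠ 0 := by
  refine div_ne_zero (sub_ne_zero.2 fun h => ?_) (sub_ne_zero.2 hq1.symm)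
  have hi : (i : ℝ) + 1 ≠ 0 := by positivity
  exact hq1 ((Real.rpow_left_inj hq0.le zero_le_one hi).1 (h.symm.trans (Real.one_rpow _).symm))

theorem qFactorial_ne_zero {q : ℝ} (hq0 : 0 < q) (hq1 : q ≠ 1) (r : ℕ) :
    qFactorial q r ≠ 0 :=
  Finset.prod_ne_zero_iff.2 fun i _ => qNum_natCast_succ_ne_zero hq0 hq1 i

theorem qNum_zero (q : ℝ) : qNum q 0 = 0 := by simp [qNum]

theorem qNum_add {q : ℝ} (hq0 : 0 < q) (x y : ℝ) :
    qNum q (x + y) = qNum q x + q ^ x * qNum q y := by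
  simp only [qNum, Real.rpow_add hq0]
  ring

theorem qFact_natCast_mul_qFactorial_sub (q : ℝ) {m n : ℕ} (h : m ≤ n) :
    qFact q n m * qFactorial q (n - m) = qFactorial q n := by
  obtain ⟨a, rfl⟩ := Nat.exists_eq_add_of_le' h
  have key := qFact_rising q ((a : ℝ) + 1) m
  rw [show (a : ℝ) + 1 + m - 1 = ((a + m : ℕ) : ℝ) by push_cast; ring] at key
  rw [key, Nat.add_sub_cancel, mul_comm, qFactorial, qFactorial, Finset.prod_range_add]
  congr 1
  refine Finset.prod_congr rfl fun i _ => ?_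
  congr 1
  push_cast
  ring

/-- The rising `q`-factorial of `x` of order `r` divided by `[r]_q!`. -/
noncomputable def qRisingBinom (q x : ℝ) (r : ℕ) : ℝ := qBinom q (x + r - 1) r

theorem qRisingBinom_zero (q x : ℝ) : qRisingBinom q x 0 = 1 := by
  simp [qRisingBinom, qBinom, qFact, qFactorial]

theorem qNum_mul_qRisingBinom_succ {q : ℝ} (hq0 : 0 < q) (hq1 : q ≠ 1) (x : ℝ) (r : ℕ) :
    qNum q ((r : ℝ) + 1) * qRisingBinom q x (r + 1) = qNum q (x + r) * qRisingBinom q x r := by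
  have h1 := qNum_natCast_succ_ne_zero hq0 hq1 r
  have h2 := qFactorial_ne_zero hq0 hq1 r
  rw [qRisingBinom, qRisingBinom, qBinom, qBinom, qFact_rising, qFact_rising,
    Finset.prod_range_succ, show qFactorial q (r + 1) = qFactorial q r * qNum q ((r : ℝ) + 1) from
      Finset.prod_range_succ _ _]
  field_simp

/-- The two-variable `q`-Vandermonde convolution for rising `q`-binomials. -/
theorem qRisingBinom_add {q : ℝ} (hq0 : 0 < q) (hq1 : q ≠ 1) (x y : ℝ) (n : ℕ) :
    qRisingBinom q (x + y) n =
      ∑ p ∈ HasAntidiagonal.antidiagonal n,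
        q ^ (x * p.2) * (qRisingBinom q x p.1 * qRisingBinom q y p.2) := by
  induction n with
  | zero => simp [qRisingBinom_zero]
  | succ n ih =>
    apply mul_left_cancel₀ (qNum_natCast_succ_ne_zero hq0 hq1 n)
    rw [qNum_mul_qRisingBinom_succ hq0 hq1, ih]
    have split : ∀ p ∈ HasAntidiagonal.antidiagonal (n + 1),
        qNum q ((n : ℝ) + 1) *
            (q ^ (x * p.2) * (qRisingBinom q x p.1 * qRisingBinom q y p.2)) =
          q ^ (x * p.2) * (qNum q p.1 * qRisingBinom q x p.1) * qRisingBinom q y p.2 +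
          q ^ (x * p.2) * q ^ (p.1 : ℝ) * qRisingBinom q x p.1 *
            (qNum q p.2 * qRisingBinom q y p.2) := by
      intro p hp
      have hp' : (n : ℝ) + 1 = p.1 + p.2 := by
        exact_mod_cast (HasAntidiagonal.mem_antidiagonal.1 hp).symm
      rw [hp', qNum_add hq0]
      ring
    rw [Finset.mul_sum, Finset.mul_sum, Finset.sum_congr rfl split, Finset.sum_add_distrib,
      Finset.Nat.sum_antidiagonal_succ, Finset.Nat.sum_antidiagonal_succ']
    simp only [Nat.cast_zero, qNum_zero, zero_mul, mul_zero, zero_add, Nat.cast_succ,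
      qNum_mul_qRisingBinom_succ hq0 hq1]
    rw [← Finset.sum_add_distrib]
    refine Finset.sum_congr rfl fun p hp => ?_
    have hp' : (n : ℝ) = p.1 + p.2 := by
      exact_mod_cast (HasAntidiagonal.mem_antidiagonal.1 hp).symm
    rw [hp', show x + y + ((p.1 : ℝ) + p.2) = (x + p.1) + (y + p.2) by ring, qNum_add hq0,
      mul_add x, Real.rpow_add hq0, Real.rpow_add hq0, mul_one]
    ring

/-- Splitting off the first coordinate in a sum over tuples with bounded sum. -/
theorem sum_filter_sum_le_succ (n k : ℕ) (f : (Fin (k + 1) → ℕ) → ℝ) :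
    ∑ r ∈ (Fintype.piFinset fun _ : Fin (k + 1) => Finset.range (n + 1)).filter
        (fun r => ∑ i, r i ≤ n), f r =
      ∑ p ∈ HasAntidiagonal.antidiagonal n,
        ∑ r ∈ (Fintype.piFinset fun _ : Fin k => Finset.range (p.2 + 1)).filter
          (fun r => ∑ i, r i ≤ p.2), f (Fin.cons p.1 r) := by
  have mem : ∀ (m l : ℕ) (r : Fin l → ℕ),
      r ∈ (Fintype.piFinset fun _ : Fin l => Finset.range (m + 1)).filter
        (fun r => ∑ i, r i ≤ m) ↔ ∑ i, r i ≤ m := by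
    intro m l r
    simp only [Finset.mem_filter, Fintype.mem_piFinset, Finset.mem_range, and_iff_right_iff_imp]
    intro h i
    have := Finset.single_le_sum (f := r) (fun _ _ => Nat.zero_le _) (Finset.mem_univ i)
    omega
  rw [Finset.sum_sigma']
  refine Finset.sum_bij' (fun r _ => ⟨(r 0, n - r 0), Fin.tail r⟩)
    (fun s _ => Fin.cons s.1.1 s.2) ?_ ?_ ?_ ?_ ?_
  · intro r hr
    rw [mem, Fin.sum_univ_succ] at hr
    rw [Finset.mem_sigma, mem, HasAntidiagonal.mem_antidiagonal]
    simp only [Fin.tail]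
    omega
  · rintro ⟨⟨a, b⟩, r⟩ hr
    rw [Finset.mem_sigma, mem, HasAntidiagonal.mem_antidiagonal] at hr
    rw [mem, Fin.sum_univ_succ]
    simp only [Fin.cons_zero, Fin.cons_succ] at hr ⊢
    omega
  · intro r _
    exact Fin.cons_self_tail r
  · rintro ⟨⟨a, b⟩, r⟩ hr
    rw [Finset.mem_sigma, HasAntidiagonal.mem_antidiagonal] at hr
    obtain rfl : b = n - a := by have := hr.1; simp only at this; omega
    simp
  · intro r _
    simp

/-- The multivariate `q`-Vandermonde convolution for rising `q`-binomials. -/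
theorem qRisingBinom_sum {q : ℝ} (hq0 : 0 < q) (hq1 : q ≠ 1) (k n : ℕ) (x : Fin (k + 1) → ℝ) :
    qRisingBinom q (∑ j, x j) n =
      ∑ r ∈ (Fintype.piFinset fun _ : Fin k => Finset.range (n + 1)).filter
          (fun r => ∑ i, r i ≤ n),
        q ^ (∑ j : Fin k, x j.castSucc *
            ((n : ℝ) -
              ∑ i ∈ Finset.univ.filter (fun i : Fin k => (i : ℕ) ≤ (j : ℕ)), (r i : ℝ))) *
          ((∏ j : Fin k, qRisingBinom q (x j.castSucc) (r j)) *
            qRisingBinom q (x (Fin.last k)) (n - ∑ i, r i)) := by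
  induction k generalizing n with
  | zero => simp
  | succ k ih =>
    rw [Fin.sum_univ_succ, qRisingBinom_add hq0 hq1, sum_filter_sum_le_succ]
    refine Finset.sum_congr rfl fun p hp => ?_
    have hn : n = p.1 + p.2 := (HasAntidiagonal.mem_antidiagonal.1 hp).symm
    rw [ih p.2 fun j => x j.succ, Finset.mul_sum, Finset.mul_sum]
    refine Finset.sum_congr rfl fun r _ => ?_
    have hsub : n - ∑ i, (Fin.cons p.1 r : Fin (k + 1) → ℕ) i = p.2 - ∑ i, r i := by
      rw [Fin.sum_univ_succ]
      simp only [Fin.cons_zero, Fin.cons_succ]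
      omega
    have hexp : (∑ j : Fin (k + 1), x j.castSucc * ((n : ℝ) -
          ∑ i ∈ Finset.univ.filter (fun i : Fin (k + 1) => (i : ℕ) ≤ (j : ℕ)),
            (((Fin.cons p.1 r : Fin (k + 1) → ℕ) i : ℕ) : ℝ))) =
        x 0 * p.2 + ∑ j : Fin k, x j.castSucc.succ * ((p.2 : ℝ) -
          ∑ i ∈ Finset.univ.filter (fun i : Fin k => (i : ℕ) ≤ (j : ℕ)), (r i : ℝ)) := by
      simp only [Finset.sum_filter, Fin.sum_univ_succ, hn]
      simp
    rw [hsub, hexp, Fin.prod_univ_succ, Real.rpow_add hq0]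
    simp only [Fin.cons_zero, Fin.cons_succ, Fin.castSucc_zero, Fin.succ_castSucc, Fin.succ_last]
    ring

/-- Multivariate `q`-Vandermonde formula, second rising version (2.8a):
`[x₁+⋯+x_{k+1}+n−1]_{n,q} = ∑ [n; r₁,…,r_k]_q q^{∑_{j=1}^{k} x_j(n−s_j)} ∏_{j=1}^{k+1}[x_j+r_j−1]_{r_j,q}`,
summed over nonnegative integers `r₁,…,r_k` with `r₁+⋯+r_k ≤ n`, where `s_j = r₁+⋯+r_j`
and `r_{k+1} = n − s_k`. -/
theorem multivariate_qVandermonde_second_rising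
    (n k : ℕ) (hn : 1 ≤ n) (hk : 1 ≤ k)
    (q : ℝ) (hq0 : 0 < q) (hq1 : q ≠ 1) (x : Fin (k + 1) → ℝ) :
    qFact q ((∑ j, x j) + n - 1) n =
      ∑ r ∈ (Fintype.piFinset fun _ : Fin k => Finset.range (n + 1)).filter
          (fun r => ∑ i, r i ≤ n),
        qMultinom q (n : ℝ) r *
          q ^ (∑ j : Fin k,
                x j.castSucc *
                  ((n : ℝ) -
                    ∑ i ∈ Finset.univ.filter (fun i : Fin k => (i : ℕ) ≤ (j : ℕ)), (r i : ℝ))) *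
          ((∏ j : Fin k, qFact q (x j.castSucc + r j - 1) (r j)) *
            qFact q (x (Fin.last k) + ((n - ∑ i, r i : ℕ) : ℝ) - 1) (n - ∑ i, r i)) := by
  have hF := qFactorial_ne_zero hq0 hq1
  have key := qRisingBinom_sum hq0 hq1 k n x
  rw [qRisingBinom, qBinom, div_eq_iff (hF n), Finset.sum_mul] at key
  rw [key]
  refine Finset.sum_congr rfl fun r hr => ?_
  have hP : ∏ i, qFactorial q (r i) ≠ 0 := Finset.prod_ne_zero_iff.2 fun i _ => hF (r i)
  have hn' := hF (n - ∑ i, r i)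
  rw [← qFact_natCast_mul_qFactorial_sub q (Finset.mem_filter.1 hr).2]
  simp only [qRisingBinom, qBinom, qMultinom, Finset.prod_div_distrib]
  field_simp
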